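/- arXiv:2009.01071 — 2 statements merged into one kernel-verified Lean document; each statement's English description precedes it below -/
import Mathlib

section
/- Let 𝒜, ℬ, 𝒞 be Fell bundles over G, with a non-degenerate action by adjointable maps of 𝒜 on ℬ and of ℬ on 𝒞. Then there exists a unique action by adjointable maps ⋆ of 𝒜 on 𝒞 such that a ⋆ (b ◇ c) = (a·b) ◇ c for all a ∈ 𝒜, b ∈ ℬ, c ∈ 𝒞; moreover ⋆ is non-degenerate. -/
/-- A Fell bundle over a group `G`, encoded as a `G`-grading of a (non-unital)
C*-algebra `A` by closed subspaces: `fiber s * fiber t ⊆ fiber (s*t)` and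
`(fiber t)* = fiber t⁻¹`.  The C*-axioms `‖b* b‖ = ‖b‖²` and positivity of
`b* b` hold in the ambient C*-algebra. -/
structure FellBundle (G : Type*) [Group G] (A : Type*) [NonUnitalCStarAlgebra A] where
  fiber : G → Submodule ℂ A
  isClosed_fiber : ∀ t, IsClosed (fiber t : Set A)
  mul_mem : ∀ {s t : G} {a b : A}, a ∈ fiber s → b ∈ fiber t → a * b ∈ fiber (s * t)
  star_mem : ∀ {t : G} {a : A}, a ∈ fiber t → star a ∈ fiber t⁻¹

variable {G : Type*} [Group G] {A B : Type*} [NonUnitalCStarAlgebra A] [NonUnitalCStarAlgebra B]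

/-- An action of a Fell bundle `𝒜` on a Fell bundle `ℬ` by adjointable maps:
`a·b ∈ B_{st}` for `a ∈ A_s`, `b ∈ B_t`; linearity in the first variable;
`a·(c·b) = (ac)·b`; and `(a·b)* d = b* (a*·d)`. -/
structure AdjAction (FA : FellBundle G A) (FB : FellBundle G B) where
  act : A → B → B
  act_mem : ∀ {s t : G} {a : A} {b : B},
    a ∈ FA.fiber s → b ∈ FB.fiber t → act a b ∈ FB.fiber (s * t)
  add_act : ∀ {s t : G} {a a' : A} {b : B},
    a ∈ FA.fiber s → a' ∈ FA.fiber s → b ∈ FB.fiber t →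
    act (a + a') b = act a b + act a' b
  smul_act : ∀ {s t : G} (c : ℂ) {a : A} {b : B},
    a ∈ FA.fiber s → b ∈ FB.fiber t → act (c • a) b = c • act a b
  assoc : ∀ {s u t : G} {a c : A} {b : B},
    a ∈ FA.fiber s → c ∈ FA.fiber u → b ∈ FB.fiber t → act a (act c b) = act (a * c) b
  adjoint : ∀ {s t u : G} {a : A} {b d : B},
    a ∈ FA.fiber s → b ∈ FB.fiber t → d ∈ FB.fiber u →
    star (act a b) * d = star b * act (star a) d

/-- Closed linear span of a subset of a normed `ℂ`-module. -/
def cspan {B : Type*} [NonUnitalCStarAlgebra B] (S : Set B) : Set B :=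
  closure ((Submodule.span ℂ S : Submodule ℂ B) : Set B)

/-- Non-degeneracy of an action by adjointable maps:
`cspan ((A_t A_{t⁻¹}) · B_e) = cspan (B_t B_{t⁻¹})` for every `t`. -/
def AdjAction.Nondeg {FA : FellBundle G A} {FB : FellBundle G B} (E : AdjAction FA FB) : Prop :=
  ∀ t : G,
    cspan {x : B | ∃ a ∈ FA.fiber t, ∃ a' ∈ FA.fiber t⁻¹, ∃ b ∈ FB.fiber (1 : G),
        x = E.act (a * a') b}
      = cspan {x : B | ∃ b ∈ FB.fiber t, ∃ b' ∈ FB.fiber t⁻¹, x = b * b'}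

section Helpers

open Filter Topology

/-- The unit fibre as a closed star subalgebra. -/
def FellBundle.unitSub (FA : FellBundle G A) : NonUnitalStarSubalgebra ℂ A where
  carrier := FA.fiber 1
  add_mem' := fun ha hb => (FA.fiber 1).add_mem ha hb
  zero_mem' := (FA.fiber 1).zero_mem
  mul_mem' := fun ha hb => by simpa using FA.mul_mem ha hb
  smul_mem' := fun c _ hx => (FA.fiber 1).smul_mem c hx
  star_mem' := fun ha => by simpa using FA.star_mem ha

theorem FellBundle.mem_unitSub (FA : FellBundle G A) (x : A) :
    x ∈ FA.unitSub ↔ x ∈ FA.fiber 1 := Iff.rfl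

theorem FellBundle.exists_approx (FA : FellBundle G A) :
    ∃ l : Filter A, l.NeBot ∧ (∀ᶠ e in l, e ∈ FA.fiber 1 ∧ ‖e‖ ≤ 1 ∧ star e = e) ∧
      ∀ a ∈ FA.fiber 1, Tendsto (fun e => e * a) l (𝓝 a) := by
  have : IsClosed (FA.unitSub : Set A) := FA.isClosed_fiber 1
  let := CStarAlgebra.spectralOrder FA.unitSub
  have := CStarAlgebra.spectralOrderedRing FA.unitSub
  have h := CStarAlgebra.increasingApproximateUnit FA.unitSub
  have := h.neBot
  refine ⟨(CStarAlgebra.approximateUnit FA.unitSub).map Subtype.val, inferInstance, ?_, ?_⟩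
  · rw [eventually_map]
    filter_upwards [h.eventually_norm, h.eventually_star_eq] with e he hs
    exact ⟨e.2, he, congrArg Subtype.val hs⟩
  · intro a ha
    rw [tendsto_map'_iff]
    have := h.tendsto_mul_right ⟨a, ha⟩
    exact (continuous_subtype_val.tendsto _).comp this

theorem FellBundle.star_mul_mem (FA : FellBundle G A) {s : G} {a : A} (ha : a ∈ FA.fiber s) :
    star a * a ∈ FA.fiber 1 := by
  simpa using FA.mul_mem (FA.star_mem ha) ha

theorem FellBundle.exists_sqrt (FA : FellBundle G A) {s : G} {a : A} (ha : a ∈ FA.fiber s)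
    (hn : ‖a‖ ≤ 1) :
    ∃ k ∈ FA.fiber 1, star k = k ∧ star a * a = (2 : ℂ) • k - k * k := by
  let := CStarAlgebra.spectralOrder A
  have := CStarAlgebra.spectralOrderedRing A
  have hh : star a * a ∈ FA.unitSub := FA.star_mul_mem ha
  set h := star a * a with hdef
  have hsa : IsSelfAdjoint h := IsSelfAdjoint.star_mul_self a
  have hnorm : ‖h‖ ≤ 1 := by
    rw [hdef, CStarRing.norm_star_mul_self]; nlinarith [norm_nonneg a]
  let f : ℝ → ℝ := fun x => 1 - Real.sqrt (1 - x)
  have hf : Continuous f := by fun_prop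
  have hf0 : f 0 = 0 := by simp [f]
  have hcl : IsClosed (FA.unitSub : Set A) := FA.isClosed_fiber 1
  refine ⟨cfcₙ f h, ?_, ?_, ?_⟩
  · have : cfcₙ f h ∈ FA.unitSub := cfcₙ_mem f hh
    exact this
  · exact (cfcₙ_predicate f h : IsSelfAdjoint _).star_eq
  · have e1 : h = cfcₙ (fun x : ℝ => (2:ℝ) • f x - f x * f x) h := by
      conv_lhs => rw [← cfcₙ_id ℝ h]
      apply cfcₙ_congr
      intro x hx
      have hx1 : x ≤ 1 := by
        have := norm_apply_le_norm_cfcₙ (id : ℝ → ℝ) h hx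
        rw [cfcₙ_id ℝ h] at this
        exact (le_abs_self x).trans (this.trans hnorm)
      have := Real.mul_self_sqrt (sub_nonneg.2 hx1)
      simp only [f, id, smul_eq_mul]
      nlinarith
    rw [cfcₙ_sub (fun x => (2:ℝ) • f x) (fun x => f x * f x) h, cfcₙ_smul (2:ℝ) f h,
      cfcₙ_mul f f h] at e1
    have e2 : (2:ℂ) • cfcₙ f h = (2:ℝ) • cfcₙ f h := by
      rw [two_smul, two_smul]
    rw [e2]
    exact e1

namespace AdjAction

variable {FA : FellBundle G A} {FB : FellBundle G B} (E : AdjAction FA FB)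

theorem ext_fib (FB : FellBundle G B) {r : G} {x y : B} (hx : x ∈ FB.fiber r)
    (hy : y ∈ FB.fiber r) (h : ∀ d ∈ FB.fiber r, star x * d = star y * d) : x = y := by
  have hd := h (x - y) ((FB.fiber r).sub_mem hx hy)
  have : star (x - y) * (x - y) = 0 := by
    rw [star_sub, sub_mul, hd, sub_self]
  exact sub_eq_zero.1 (CStarRing.star_mul_self_eq_zero_iff _ |>.1 this)

variable {E} in
theorem act_add {s t : G} {a : A} {b b' : B} (ha : a ∈ FA.fiber s) (hb : b ∈ FB.fiber t)
    (hb' : b' ∈ FB.fiber t) : E.act a (b + b') = E.act a b + E.act a b' := by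
  have hbb := (FB.fiber t).add_mem hb hb'
  refine ext_fib FB (E.act_mem ha hbb)
    ((FB.fiber _).add_mem (E.act_mem ha hb) (E.act_mem ha hb')) fun d hd => ?_
  rw [E.adjoint ha hbb hd, star_add, star_add, add_mul, add_mul, E.adjoint ha hb hd,
    E.adjoint ha hb' hd]

variable {E} in
theorem act_smul {s t : G} {a : A} {b : B} (c : ℂ) (ha : a ∈ FA.fiber s) (hb : b ∈ FB.fiber t) :
    E.act a (c • b) = c • E.act a b := by
  have hbb := (FB.fiber t).smul_mem c hb
  refine ext_fib FB (E.act_mem ha hbb)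
    ((FB.fiber _).smul_mem c (E.act_mem ha hb)) fun d hd => ?_
  rw [E.adjoint ha hbb hd, star_smul, star_smul, smul_mul_assoc, smul_mul_assoc,
    E.adjoint ha hb hd]

variable {E} in
theorem act_sub {s t : G} {a : A} {b b' : B} (ha : a ∈ FA.fiber s) (hb : b ∈ FB.fiber t)
    (hb' : b' ∈ FB.fiber t) : E.act a (b - b') = E.act a b - E.act a b' := by
  have h := act_add (E := E) ha ((FB.fiber t).sub_mem hb hb') hb'
  rw [sub_add_cancel] at h
  rw [h, add_sub_cancel_right]

variable {E} in
theorem sub_act {s t : G} {a a' : A} {b : B} (ha : a ∈ FA.fiber s) (ha' : a' ∈ FA.fiber s)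
    (hb : b ∈ FB.fiber t) : E.act (a - a') b = E.act a b - E.act a' b := by
  have h := E.add_act ((FA.fiber s).sub_mem ha ha') ha' hb
  rw [sub_add_cancel] at h
  rw [h, add_sub_cancel_right]

variable {E} in
theorem act_mul {s t u : G} {a : A} {b d : B} (ha : a ∈ FA.fiber s) (hb : b ∈ FB.fiber t)
    (hd : d ∈ FB.fiber u) : E.act a b * d = E.act a (b * d) := by
  refine ext_fib FB (r := s * t * u) (FB.mul_mem (E.act_mem ha hb) hd)
    (by rw [mul_assoc]; exact E.act_mem ha (FB.mul_mem hb hd)) fun f hf => ?_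
  rw [star_mul, mul_assoc, E.adjoint ha hb hf, E.adjoint ha (FB.mul_mem hb hd) hf, star_mul,
    mul_assoc]

variable {E} in
theorem norm_act_le_of_le_one {s t : G} {a : A} {b : B} (ha : a ∈ FA.fiber s)
    (hb : b ∈ FB.fiber t) (hn : ‖a‖ ≤ 1) : ‖E.act a b‖ ≤ ‖b‖ := by
  let := CStarAlgebra.spectralOrder B
  have := CStarAlgebra.spectralOrderedRing B
  obtain ⟨k, hk, hks, hka⟩ := FA.exists_sqrt ha hn
  have hkb : E.act k b ∈ FB.fiber t := by simpa using E.act_mem hk hb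
  have hkk : k * k ∈ FA.fiber 1 := by simpa using FA.mul_mem hk hk
  have h1 : star (E.act a b) * E.act a b = star b * E.act (star a * a) b := by
    rw [E.adjoint ha hb (E.act_mem ha hb), E.assoc (FA.star_mem ha) ha hb]
  have h2 : E.act (star a * a) b = (2:ℂ) • E.act k b - E.act k (E.act k b) := by
    rw [hka, sub_act ((FA.fiber 1).smul_mem _ hk) hkk hb, E.smul_act _ hk hb, E.assoc hk hk hb]
  have hadj : ∀ d ∈ FB.fiber t, star (E.act k b) * d = star b * E.act k d := fun d hd => by
    rw [E.adjoint hk hb hd, hks]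
  have h3 : star b * b - star (E.act a b) * E.act a b
      = star (b - E.act k b) * (b - E.act k b) := by
    rw [h1, h2, star_sub, sub_mul, mul_sub, mul_sub (star (E.act k b)), hadj b hb, hadj _ hkb,
      mul_sub, two_smul, mul_add]
    abel
  have h4 : star (E.act a b) * E.act a b ≤ star b * b := by
    rw [← sub_nonneg, h3]; exact star_mul_self_nonneg _
  have h5 := CStarAlgebra.norm_le_norm_of_nonneg_of_le (star_mul_self_nonneg _) h4
  rw [CStarRing.norm_star_mul_self, CStarRing.norm_star_mul_self] at h5
  nlinarith [norm_nonneg b, norm_nonneg (E.act a b)]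

variable {E} in
theorem norm_act_le {s t : G} {a : A} {b : B} (ha : a ∈ FA.fiber s)
    (hb : b ∈ FB.fiber t) : ‖E.act a b‖ ≤ ‖a‖ * ‖b‖ := by
  rcases eq_or_ne a 0 with rfl | h0
  · have := E.smul_act (0:ℂ) ha hb
    rw [zero_smul, zero_smul] at this
    simp [this]
  · have hp : 0 < ‖a‖ := norm_pos_iff.2 h0
    have h := norm_act_le_of_le_one (E := E) (a := ((‖a‖⁻¹ : ℝ) : ℂ) • a)
      ((FA.fiber s).smul_mem _ ha) hb (by
        rw [norm_smul, Complex.norm_real, norm_inv, norm_norm, inv_mul_cancel₀ hp.ne'])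
    rw [E.smul_act _ ha hb, norm_smul, Complex.norm_real, norm_inv, norm_norm,
      inv_mul_le_iff₀ hp] at h
    exact h

/-- Approximate unit of the unit fibre, seen as a filter on the ambient algebra. -/
structure IsAU (FB : FellBundle G B) (l : Filter B) : Prop where
  neBot : l.NeBot
  ev : ∀ᶠ e in l, e ∈ FB.fiber 1 ∧ ‖e‖ ≤ 1 ∧ star e = e
  lim : ∀ a ∈ FB.fiber 1, Tendsto (fun e => e * a) l (𝓝 a)

/-- A Fell bundle acts on itself by left multiplication. -/
def selfAct (FB : FellBundle G B) : AdjAction FB FB where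
  act a b := a * b
  act_mem := fun ha hb => FB.mul_mem ha hb
  add_act := fun _ _ _ => add_mul _ _ _
  smul_act := fun c _ _ _ _ => smul_mul_assoc c _ _
  assoc := fun _ _ _ => (mul_assoc _ _ _).symm
  adjoint := fun _ _ _ => by rw [star_mul, mul_assoc]

theorem mul_star_mem (FB : FellBundle G B) {t : G} {b : B} (hb : b ∈ FB.fiber t) :
    b * star b ∈ FB.fiber 1 := by
  simpa using FB.mul_mem hb (FB.star_mem hb)

theorem one_act_mem {t : G} {a : A} {b : B} (ha : a ∈ FA.fiber 1) (hb : b ∈ FB.fiber t) :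
    E.act a b ∈ FB.fiber t := by
  simpa using E.act_mem ha hb

theorem tendsto_of_mul_star {l : Filter A} (hl : IsAU FA l) {t : G} {b : B}
    (hb : b ∈ FB.fiber t)
    (h : Tendsto (fun e => E.act e (b * star b)) l (𝓝 (b * star b))) :
    Tendsto (fun e => E.act e b) l (𝓝 b) := by
  rw [tendsto_iff_norm_sub_tendsto_zero] at h ⊢
  have hs : Tendsto (fun e => Real.sqrt (2 * ‖E.act e (b * star b) - b * star b‖)) l (𝓝 0) := by
    have := (Real.continuous_sqrt.tendsto _).comp (h.const_mul 2)
    rw [mul_zero, Real.sqrt_zero] at this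
    exact this
  refine squeeze_zero' (Eventually.of_forall fun _ => norm_nonneg _) ?_ hs
  filter_upwards [hl.ev] with e ⟨he, hn, _⟩
  apply Real.le_sqrt_of_sq_le
  have heb := E.one_act_mem he hb
  set w := E.act e b - b with hw
  have hwm : w ∈ FB.fiber t := (FB.fiber t).sub_mem heb hb
  have e1 : w * star b = E.act e (b * star b) - b * star b := by
    rw [hw, sub_mul, act_mul he hb (FB.star_mem hb)]
  have e2 : w * star w = star (E.act e (b * star w)) - w * star b := by
    rw [← act_mul he hb (FB.star_mem hwm), star_mul, star_star, ← mul_sub, ← star_sub]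
  have e3 : ‖E.act e (b * star w)‖ ≤ ‖w * star b‖ := by
    refine (norm_act_le he (FB.mul_mem hb (FB.star_mem hwm))).trans ?_
    have : ‖b * star w‖ = ‖w * star b‖ := by
      rw [← norm_star, star_mul, star_star]
    rw [this]
    exact mul_le_of_le_one_left (norm_nonneg _) hn
  calc ‖w‖ ^ 2 = ‖w * star w‖ := by rw [CStarRing.norm_self_mul_star, sq]
    _ ≤ ‖star (E.act e (b * star w))‖ + ‖w * star b‖ := by rw [e2]; exact norm_sub_le _ _
    _ ≤ 2 * ‖w * star b‖ := by rw [norm_star]; linarith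
    _ = _ := by rw [e1]

theorem tendsto_mul {l : Filter B} (hl : IsAU FB l) {t : G} {b : B} (hb : b ∈ FB.fiber t) :
    Tendsto (fun e => e * b) l (𝓝 b) :=
  tendsto_of_mul_star (selfAct FB) hl hb (hl.lim _ (mul_star_mem FB hb))

theorem cspan_subset {S : Set B} {K : Submodule ℂ B} (hK : IsClosed (K : Set B))
    (h : S ⊆ K) : cspan S ⊆ K :=
  closure_minimal (Submodule.span_le.2 h) hK

theorem subset_cspan {S : Set B} : S ⊆ cspan S :=
  Submodule.subset_span.trans subset_closure

/-- The closed span as a submodule. -/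
def cspanSub (S : Set B) : Submodule ℂ B := (Submodule.span ℂ S).topologicalClosure

theorem coe_cspanSub (S : Set B) : (cspanSub S : Set B) = cspan S := rfl

theorem continuousOn_left {t : G} (s : G) {b : B} (hb : b ∈ FB.fiber t) :
    ContinuousOn (fun a => E.act a b) (FA.fiber s : Set A) := by
  have : LipschitzOnWith ‖b‖₊ (fun a => E.act a b) (FA.fiber s : Set A) := by
    refine LipschitzOnWith.of_dist_le_mul fun x hx y hy => ?_
    rw [dist_eq_norm, dist_eq_norm, ← sub_act hx hy hb, mul_comm]
    exact norm_act_le ((FA.fiber s).sub_mem hx hy) hb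
  exact this.continuousOn

theorem continuousOn_right {s : G} (t : G) {a : A} (ha : a ∈ FA.fiber s) :
    ContinuousOn (fun b => E.act a b) (FB.fiber t : Set B) := by
  have : LipschitzOnWith ‖a‖₊ (fun b => E.act a b) (FB.fiber t : Set B) := by
    refine LipschitzOnWith.of_dist_le_mul fun x hx y hy => ?_
    rw [dist_eq_norm, dist_eq_norm, ← act_sub ha hx hy]
    exact norm_act_le ha ((FB.fiber t).sub_mem hx hy)
  exact this.continuousOn

theorem tendsto_left {ι : Type*} {l : Filter ι} {f : ι → A} {s t : G} {a : A} {b : B}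
    (hb : b ∈ FB.fiber t)
    (ha : a ∈ FA.fiber s) (hf : ∀ᶠ i in l, f i ∈ FA.fiber s) (h : Tendsto f l (𝓝 a)) :
    Tendsto (fun i => E.act (f i) b) l (𝓝 (E.act a b)) :=
  ((E.continuousOn_left s hb) a ha).tendsto.comp
    (tendsto_nhdsWithin_iff.2 ⟨h, hf⟩)

theorem tendsto_right {ι : Type*} {l : Filter ι} {f : ι → B} {s t : G} {a : A} {b : B}
    (ha : a ∈ FA.fiber s)
    (hb : b ∈ FB.fiber t) (hf : ∀ᶠ i in l, f i ∈ FB.fiber t) (h : Tendsto f l (𝓝 b)) :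
    Tendsto (fun i => E.act a (f i)) l (𝓝 (E.act a b)) :=
  ((E.continuousOn_right t ha) b hb).tendsto.comp
    (tendsto_nhdsWithin_iff.2 ⟨h, hf⟩)

/-- Elements of the unit fibre on which the approximate unit converges. -/
def convSub {l : Filter A} (hl : IsAU FA l) : Submodule ℂ B where
  carrier := {y | y ∈ FB.fiber 1 ∧ Tendsto (fun e => E.act e y) l (𝓝 y)}
  zero_mem' := by
    refine ⟨(FB.fiber 1).zero_mem, ?_⟩
    refine tendsto_const_nhds.congr' ?_
    filter_upwards [hl.ev] with e ⟨he, _⟩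
    have := act_smul (E := E) (0:ℂ) he (FB.fiber 1).zero_mem
    simpa using this.symm
  add_mem' := by
    rintro x y ⟨hx, hx'⟩ ⟨hy, hy'⟩
    refine ⟨(FB.fiber 1).add_mem hx hy, (hx'.add hy').congr' ?_⟩
    filter_upwards [hl.ev] with e ⟨he, _⟩
    exact (act_add he hx hy).symm
  smul_mem' := by
    rintro c x ⟨hx, hx'⟩
    refine ⟨(FB.fiber 1).smul_mem c hx, (hx'.const_smul c).congr' ?_⟩
    filter_upwards [hl.ev] with e ⟨he, _⟩
    exact (act_smul c he hx).symm

theorem isClosed_convSub {l : Filter A} (hl : IsAU FA l) :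
    IsClosed (E.convSub hl : Set B) := by
  refine isClosed_of_closure_subset fun y hy => ?_
  have hy1 : y ∈ FB.fiber 1 :=
    closure_minimal (fun z hz => hz.1) (FB.isClosed_fiber 1) hy
  refine ⟨hy1, ?_⟩
  rw [Metric.tendsto_nhds]
  intro ε hε
  obtain ⟨z, hz, hyz⟩ := Metric.mem_closure_iff.1 hy (ε / 3) (by positivity)
  filter_upwards [hl.ev, Metric.tendsto_nhds.1 hz.2 (ε / 3) (by positivity)]
    with e ⟨he, hn, _⟩ hez
  have h1 : dist (E.act e y) (E.act e z) ≤ dist y z := by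
    rw [dist_eq_norm, dist_eq_norm, ← act_sub he hy1 hz.1]
    exact (norm_act_le he ((FB.fiber 1).sub_mem hy1 hz.1)).trans
      (mul_le_of_le_one_left (norm_nonneg _) hn)
  have h2 := dist_triangle4 (E.act e y) (E.act e z) z y
  rw [dist_comm z y] at h2
  linarith

theorem tendsto_act (hE : E.Nondeg) {l : Filter A} (hl : IsAU FA l) {t : G} {b : B}
    (hb : b ∈ FB.fiber t) : Tendsto (fun e => E.act e b) l (𝓝 b) := by
  refine E.tendsto_of_mul_star hl hb ?_
  have h1 : b * star b ∈ cspan {x : B | ∃ b ∈ FB.fiber t, ∃ b' ∈ FB.fiber t⁻¹, x = b * b'} :=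
    subset_cspan ⟨b, hb, star b, FB.star_mem hb, rfl⟩
  rw [← hE t] at h1
  refine (cspan_subset (E.isClosed_convSub hl) ?_ h1).2
  rintro _ ⟨a, ha, a', ha', c, hc, rfl⟩
  have haa : a * a' ∈ FA.fiber 1 := by simpa using FA.mul_mem ha ha'
  refine ⟨E.one_act_mem haa hc, ?_⟩
  have hev : ∀ᶠ e in l, e * (a * a') ∈ FA.fiber 1 := by
    filter_upwards [hl.ev] with e he
    simpa using FA.mul_mem he.1 haa
  refine (E.tendsto_left hc haa hev (hl.lim _ haa)).congr' ?_
  filter_upwards [hl.ev] with e he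
  rw [E.assoc he.1 haa hc]

section Comp

variable {C : Type*} [NonUnitalCStarAlgebra C] {FC : FellBundle G C}
  (E1 : AdjAction FA FB) (E2 : AdjAction FB FC)

/-- The composite action. -/
noncomputable def compFun (l : Filter B) (a : A) (c : C) : C :=
  limUnder l (fun e => E2.act (E1.act a e) c)

theorem tendsto_elem (h2 : E2.Nondeg) {l : Filter B} (hl : IsAU FB l) {s t u : G} {a : A} {b : B}
    {c : C} (ha : a ∈ FA.fiber s) (hb : b ∈ FB.fiber t) (hc : c ∈ FC.fiber u) :
    Tendsto (fun e => E2.act (E1.act a e) (E2.act b c)) l (𝓝 (E2.act (E1.act a b) c)) := by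
  have hev : ∀ᶠ e in l, e * b ∈ FB.fiber t := by
    filter_upwards [hl.ev] with e he
    simpa using FB.mul_mem he.1 hb
  have hev2 : ∀ᶠ e in l, E1.act a (e * b) ∈ FB.fiber (s * t) := by
    filter_upwards [hev] with e he
    exact E1.act_mem ha he
  refine (E2.tendsto_left hc (E1.act_mem ha hb) hev2
    (E1.tendsto_right ha hb hev (tendsto_mul hl hb))).congr' ?_
  filter_upwards [hl.ev] with e he
  rw [E2.assoc (E1.act_mem ha he.1) hb hc, act_mul ha he.1 hb]

theorem tendsto_comp (h2 : E2.Nondeg) {l : Filter B} (hl : IsAU FB l) {s u : G} {a : A}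
    {c : C} (ha : a ∈ FA.fiber s) (hc : c ∈ FC.fiber u) :
    Tendsto (fun e => E2.act (E1.act a e) c) l (𝓝 (compFun E1 E2 l a c)) := by
  have := hl.neBot
  refine tendsto_nhds_limUnder (cauchy_map_iff_exists_tendsto.1 ?_)
  refine Metric.cauchy_iff.2 ⟨inferInstance, fun ε hε => ?_⟩
  have h0 : Tendsto (fun e => ‖a‖ * dist (E2.act e c) c) l (𝓝 0) := by
    have := (tendsto_iff_dist_tendsto_zero.1 (E2.tendsto_act h2 hl hc)).const_mul ‖a‖
    simpa using this
  obtain ⟨e', hlt, he', -⟩ :=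
    ((h0.eventually (gt_mem_nhds (show 0 < ε / 4 by positivity))).and hl.ev).exists
  have h1 := tendsto_elem E1 E2 h2 hl ha he' hc
  have key : ∀ᶠ e in l, dist (E2.act (E1.act a e) c) (E2.act (E1.act a e') c) < ε / 2 := by
    filter_upwards [hl.ev, Metric.tendsto_nhds.1 h1 (ε / 4) (by positivity)]
      with e ⟨he, hn, _⟩ hd
    have h3 : dist (E2.act (E1.act a e) c) (E2.act (E1.act a e) (E2.act e' c)) < ε / 4 := by
      have hm := E2.one_act_mem he' hc
      have hae := E1.act_mem ha he
      rw [dist_comm, dist_eq_norm, ← act_sub hae hm hc]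
      refine (norm_act_le hae ((FC.fiber u).sub_mem hm hc)).trans_lt ?_
      rw [← dist_eq_norm]
      refine lt_of_le_of_lt (mul_le_mul_of_nonneg_right ?_ dist_nonneg) hlt
      exact (norm_act_le ha he).trans (mul_le_of_le_one_right (norm_nonneg _) hn)
    have := dist_triangle (E2.act (E1.act a e) c) (E2.act (E1.act a e) (E2.act e' c))
      (E2.act (E1.act a e') c)
    linarith
  refine ⟨_, image_mem_map key, ?_⟩
  rintro _ ⟨x, hx, rfl⟩ _ ⟨y, hy, rfl⟩
  simp only [Set.mem_setOf_eq] at hx hy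
  have := dist_triangle_right (E2.act (E1.act a x) c) (E2.act (E1.act a y) c)
    (E2.act (E1.act a e') c)
  linarith

theorem compFun_elem (h2 : E2.Nondeg) {l : Filter B} (hl : IsAU FB l) {s t u : G} {a : A} {b : B}
    {c : C} (ha : a ∈ FA.fiber s) (hb : b ∈ FB.fiber t) (hc : c ∈ FC.fiber u) :
    compFun E1 E2 l a (E2.act b c) = E2.act (E1.act a b) c :=
  have := hl.neBot
  tendsto_nhds_unique (tendsto_comp E1 E2 h2 hl ha (E2.act_mem hb hc))
    (tendsto_elem E1 E2 h2 hl ha hb hc)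

theorem compFun_mem (h2 : E2.Nondeg) {l : Filter B} (hl : IsAU FB l) {s u : G} {a : A}
    {c : C} (ha : a ∈ FA.fiber s) (hc : c ∈ FC.fiber u) :
    compFun E1 E2 l a c ∈ FC.fiber (s * u) := by
  have := hl.neBot
  refine (FC.isClosed_fiber _).mem_of_tendsto (tendsto_comp E1 E2 h2 hl ha hc) ?_
  filter_upwards [hl.ev] with e he
  have := E1.act_mem ha he.1
  rw [mul_one] at this
  exact E2.act_mem this hc

theorem compFun_adjoint (h2 : E2.Nondeg) {l : Filter B} (hl : IsAU FB l) {s t u : G} {a : A}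
    {c d : C} (ha : a ∈ FA.fiber s) (hc : c ∈ FC.fiber t) (hd : d ∈ FC.fiber u) :
    star (compFun E1 E2 l a c) * d = star c * compFun E1 E2 l (star a) d := by
  have := hl.neBot
  have hsa := FA.star_mem ha
  have L1 : Tendsto (fun e => star (compFun E1 E2 l a c) * E2.act e d) l
      (𝓝 (star (compFun E1 E2 l a c) * d)) := (E2.tendsto_act h2 hl hd).const_mul _
  have L2 : Tendsto (fun e => star c * E2.act (E1.act (star a) e) d) l
      (𝓝 (star c * compFun E1 E2 l (star a) d)) :=
    (tendsto_comp E1 E2 h2 hl hsa hd).const_mul _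
  refine tendsto_nhds_unique (L1.congr' ?_) L2
  filter_upwards [hl.ev] with e ⟨he, _⟩
  have hae := E1.act_mem hsa he
  have M1 : Tendsto (fun e' => star (E2.act (E1.act a e') c) * E2.act e d) l
      (𝓝 (star (compFun E1 E2 l a c) * E2.act e d)) :=
    ((continuous_star.tendsto _).comp (tendsto_comp E1 E2 h2 hl ha hc)).mul_const _
  have M2 : Tendsto (fun e' => star c * E2.act e' (E2.act (E1.act (star a) e) d)) l
      (𝓝 (star c * E2.act (E1.act (star a) e) d)) :=
    (E2.tendsto_act h2 hl (E2.act_mem hae hd)).const_mul _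
  refine tendsto_nhds_unique (M1.congr' ?_) M2
  filter_upwards [hl.ev] with e' ⟨he', _, hs'⟩
  have hae' := E1.act_mem ha he'
  rw [E2.adjoint hae' hc (E2.act_mem he hd), E2.assoc (FB.star_mem hae') he hd,
    E1.adjoint ha he' he, hs', E2.assoc he' hae hd]

theorem compFun_add (h2 : E2.Nondeg) {l : Filter B} (hl : IsAU FB l) {s t : G} {a a' : A}
    {c : C} (ha : a ∈ FA.fiber s) (ha' : a' ∈ FA.fiber s) (hc : c ∈ FC.fiber t) :
    compFun E1 E2 l (a + a') c = compFun E1 E2 l a c + compFun E1 E2 l a' c := by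
  have := hl.neBot
  refine tendsto_nhds_unique (tendsto_comp E1 E2 h2 hl ((FA.fiber s).add_mem ha ha') hc)
    (((tendsto_comp E1 E2 h2 hl ha hc).add (tendsto_comp E1 E2 h2 hl ha' hc)).congr' ?_)
  filter_upwards [hl.ev] with e ⟨he, _⟩
  rw [E1.add_act ha ha' he, E2.add_act (E1.act_mem ha he) (E1.act_mem ha' he) hc]

theorem compFun_smul (h2 : E2.Nondeg) {l : Filter B} (hl : IsAU FB l) {s t : G} (z : ℂ) {a : A}
    {c : C} (ha : a ∈ FA.fiber s) (hc : c ∈ FC.fiber t) :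
    compFun E1 E2 l (z • a) c = z • compFun E1 E2 l a c := by
  have := hl.neBot
  refine tendsto_nhds_unique (tendsto_comp E1 E2 h2 hl ((FA.fiber s).smul_mem z ha) hc)
    (((tendsto_comp E1 E2 h2 hl ha hc).const_smul z).congr' ?_)
  filter_upwards [hl.ev] with e ⟨he, _⟩
  rw [E1.smul_act z ha he, E2.smul_act z (E1.act_mem ha he) hc]

theorem compFun_assoc (h2 : E2.Nondeg) {l : Filter B} (hl : IsAU FB l) {s u t : G} {a a' : A}
    {c : C} (ha : a ∈ FA.fiber s) (ha' : a' ∈ FA.fiber u) (hc : c ∈ FC.fiber t) :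
    compFun E1 E2 l a (compFun E1 E2 l a' c) = compFun E1 E2 l (a * a') c := by
  have := hl.neBot
  have hx := compFun_mem E1 E2 h2 hl ha' hc
  have hy := compFun_mem E1 E2 h2 hl ha hx
  have hz : compFun E1 E2 l (a * a') c ∈ FC.fiber (s * (u * t)) := by
    rw [← mul_assoc]; exact compFun_mem E1 E2 h2 hl (FA.mul_mem ha ha') hc
  refine ext_fib FC hy hz fun d hd => ?_
  rw [compFun_adjoint E1 E2 h2 hl ha hx hd, compFun_adjoint E1 E2 h2 hl (FA.mul_mem ha ha') hc hd]
  have L : Tendsto (fun e => star c * E2.act (E1.act (star (a * a')) e) d) l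
      (𝓝 (star c * compFun E1 E2 l (star (a * a')) d)) :=
    (tendsto_comp E1 E2 h2 hl (FA.star_mem (FA.mul_mem ha ha')) hd).const_mul _
  have L2 : Tendsto (fun e => star (compFun E1 E2 l a' c) * E2.act (E1.act (star a) e) d) l
      (𝓝 (star (compFun E1 E2 l a' c) * compFun E1 E2 l (star a) d)) :=
    (tendsto_comp E1 E2 h2 hl (FA.star_mem ha) hd).const_mul _
  refine tendsto_nhds_unique (L2.congr' ?_) L
  filter_upwards [hl.ev] with e ⟨he, _⟩
  have hae := E1.act_mem (FA.star_mem ha) he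
  rw [compFun_adjoint E1 E2 h2 hl ha' hc (E2.act_mem hae hd),
    compFun_elem E1 E2 h2 hl (FA.star_mem ha') hae hd, E1.assoc (FA.star_mem ha') (FA.star_mem ha) he,
    star_mul]

/-- The composite action, as an action by adjointable maps. -/
noncomputable def comp (h2 : E2.Nondeg) {l : Filter B} (hl : IsAU FB l) : AdjAction FA FC where
  act := compFun E1 E2 l
  act_mem := compFun_mem E1 E2 h2 hl
  add_act := compFun_add E1 E2 h2 hl
  smul_act := fun z _ _ => compFun_smul E1 E2 h2 hl z
  assoc := compFun_assoc E1 E2 h2 hl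
  adjoint := compFun_adjoint E1 E2 h2 hl

/-- Elements of the unit fibre whose action on `c` lands in a given submodule. -/
def preSub (E2 : AdjAction FB FC) {u : G} {c : C} (hc : c ∈ FC.fiber u) (M : Submodule ℂ C) :
    Submodule ℂ B where
  carrier := {b | b ∈ FB.fiber 1 ∧ E2.act b c ∈ M}
  zero_mem' := by
    refine ⟨(FB.fiber 1).zero_mem, ?_⟩
    have := E2.smul_act (0:ℂ) (FB.fiber 1).zero_mem hc
    rw [zero_smul, zero_smul] at this
    rw [this]; exact M.zero_mem
  add_mem' := by
    rintro x y ⟨hx, hx'⟩ ⟨hy, hy'⟩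
    refine ⟨(FB.fiber 1).add_mem hx hy, ?_⟩
    rw [E2.add_act hx hy hc]; exact M.add_mem hx' hy'
  smul_mem' := by
    rintro z x ⟨hx, hx'⟩
    refine ⟨(FB.fiber 1).smul_mem z hx, ?_⟩
    rw [E2.smul_act z hx hc]; exact M.smul_mem z hx'

theorem isClosed_preSub {u : G} {c : C} (hc : c ∈ FC.fiber u) {M : Submodule ℂ C}
    (hM : IsClosed (M : Set C)) : IsClosed (preSub E2 hc M : Set B) :=
  (E2.continuousOn_left 1 hc).preimage_isClosed_of_isClosed (FB.isClosed_fiber 1) hM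

theorem comp_nondeg (h1 : E1.Nondeg) (h2 : E2.Nondeg) {l : Filter B} (hl : IsAU FB l) :
    (comp E1 E2 h2 hl).Nondeg := by
  have := hl.neBot
  intro t
  apply Set.Subset.antisymm
  · refine cspan_subset (K := cspanSub _) isClosed_closure ?_
    rintro _ ⟨a, ha, a', ha', c, hc, rfl⟩
    have haa : a * a' ∈ FA.fiber 1 := by simpa using FA.mul_mem ha ha'
    refine (isClosed_closure (s := _)).mem_of_tendsto (tendsto_comp E1 E2 h2 hl haa hc) ?_
    filter_upwards [hl.ev] with e ⟨he, _⟩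
    have hm : E1.act (a * a') e ∈
        cspan {x : B | ∃ b ∈ FB.fiber t, ∃ b' ∈ FB.fiber t⁻¹, x = b * b'} := by
      rw [← h1 t]
      exact subset_cspan ⟨a, ha, a', ha', e, he, rfl⟩
    refine (cspan_subset (isClosed_preSub E2 hc (M := cspanSub
      {x : C | ∃ b ∈ FC.fiber t, ∃ b' ∈ FC.fiber t⁻¹, x = b * b'}) isClosed_closure) ?_ hm).2
    rintro _ ⟨b, hb, b', hb', rfl⟩
    refine ⟨by simpa using FB.mul_mem hb hb', ?_⟩
    rw [← SetLike.mem_coe, coe_cspanSub, ← h2 t]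
    exact subset_cspan ⟨b, hb, b', hb', c, hc, rfl⟩
  · rw [← h2 t]
    refine cspan_subset (K := cspanSub _) isClosed_closure ?_
    rintro _ ⟨b, hb, b', hb', c, hc, rfl⟩
    have hm : b * b' ∈ cspan {x : B | ∃ b ∈ FB.fiber t, ∃ b' ∈ FB.fiber t⁻¹, x = b * b'} :=
      subset_cspan ⟨b, hb, b', hb', rfl⟩
    rw [← h1 t] at hm
    refine (cspan_subset (isClosed_preSub E2 hc (M := cspanSub _) isClosed_closure) ?_ hm).2
    rintro _ ⟨a, ha, a', ha', f, hf, rfl⟩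
    have haa : a * a' ∈ FA.fiber 1 := by simpa using FA.mul_mem ha ha'
    refine ⟨E1.one_act_mem haa hf, ?_⟩
    refine subset_cspan ⟨a, ha, a', ha', E2.act f c, E2.one_act_mem hf hc, ?_⟩
    exact (compFun_elem E1 E2 h2 hl haa hf hc).symm

end Comp

end AdjAction

end Helpers

/-- Given non-degenerate actions by adjointable maps of `𝒜` on `ℬ` and of `ℬ`
on `𝒞`, there exists a unique action by adjointable maps `⋆` of `𝒜` on `𝒞`
satisfying `a ⋆ (b ◇ c) = (a·b) ◇ c` for all bundle elements; moreover `⋆` is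
non-degenerate. -/
theorem adjAction_comp_exists_unique {C : Type*} [NonUnitalCStarAlgebra C]
    {FA : FellBundle G A} {FB : FellBundle G B} {FC : FellBundle G C}
    (E1 : AdjAction FA FB) (E2 : AdjAction FB FC)
    (h1 : E1.Nondeg) (h2 : E2.Nondeg) :
    ∃ E : AdjAction FA FC,
      (∀ (s t u : G) (a : A) (b : B) (c : C),
        a ∈ FA.fiber s → b ∈ FB.fiber t → c ∈ FC.fiber u →
        E.act a (E2.act b c) = E2.act (E1.act a b) c) ∧
      E.Nondeg ∧
      (∀ E' : AdjAction FA FC,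
        (∀ (s t u : G) (a : A) (b : B) (c : C),
          a ∈ FA.fiber s → b ∈ FB.fiber t → c ∈ FC.fiber u →
          E'.act a (E2.act b c) = E2.act (E1.act a b) c) →
        ∀ (s u : G) (a : A) (c : C), a ∈ FA.fiber s → c ∈ FC.fiber u →
          E'.act a c = E.act a c) := by
  obtain ⟨l, hne, hev, hlim⟩ := FB.exists_approx
  have hl : AdjAction.IsAU FB l := ⟨hne, hev, hlim⟩
  refine ⟨AdjAction.comp E1 E2 h2 hl, ?_, AdjAction.comp_nondeg E1 E2 h1 h2 hl, ?_⟩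
  · intro s t u a b c ha hb hc
    exact AdjAction.compFun_elem E1 E2 h2 hl ha hb hc
  · intro E' hE' s u a c ha hc
    have hm : ∀ᶠ e in l, E2.act e c ∈ FC.fiber u := by
      filter_upwards [hl.ev] with e he
      exact E2.one_act_mem he.1 hc
    refine tendsto_nhds_unique (E'.tendsto_right ha hc hm (E2.tendsto_act h2 hl hc))
      ((AdjAction.tendsto_comp E1 E2 h2 hl ha hc).congr' ?_)
    filter_upwards [hl.ev] with e he
    exact (hE' s 1 u a e c ha he.1 hc).symm
end

section
/- Let T : 𝒟 → B(V) be a non-degenerate *-representation of a Fell bundle 𝒟 on a Hilbert space V, and let 𝒞 × 𝒟 → 𝒟 be a non-degenerate action by adjointable maps of a Fell bundle 𝒞 on 𝒟. Then there exists a unique *-representation T̂ : 𝒞 → B(V) such that T̂_c T_d ξ = T_{c·d} ξ for all c ∈ 𝒞, d ∈ 𝒟, ξ ∈ V; moreover T̂ is non-degenerate. -/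
variable {G : Type*} [Group G] {A B : Type*} [NonUnitalCStarAlgebra A] [NonUnitalCStarAlgebra B]

/-- A *-representation of a Fell bundle `𝒟` on a Hilbert space `V`: fiberwise
linear, multiplicative (`T_d T_{d'} = T_{dd'}`) and star-preserving
(`T_{d*} = T_d*`). -/
structure FellRep {D : Type*} [NonUnitalCStarAlgebra D] (FD : FellBundle G D)
    (V : Type*) [NormedAddCommGroup V] [InnerProductSpace ℂ V] [CompleteSpace V] where
  T : D → (V →L[ℂ] V)
  add_rep : ∀ {t : G} {d d' : D}, d ∈ FD.fiber t → d' ∈ FD.fiber t →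
    T (d + d') = T d + T d'
  smul_rep : ∀ {t : G} (c : ℂ) {d : D}, d ∈ FD.fiber t → T (c • d) = c • T d
  mul_rep : ∀ {s t : G} {d d' : D}, d ∈ FD.fiber s → d' ∈ FD.fiber t →
    T (d * d') = (T d).comp (T d')
  star_rep : ∀ {t : G} {d : D}, d ∈ FD.fiber t →
    T (star d) = ContinuousLinearMap.adjoint (T d)

/-- Non-degeneracy of a *-representation: `span {T_d ξ : d ∈ D_e, ξ ∈ V}` is
dense in `V`. -/
def FellRep.Nondeg {D : Type*} [NonUnitalCStarAlgebra D] {FD : FellBundle G D}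
    {V : Type*} [NormedAddCommGroup V] [InnerProductSpace ℂ V] [CompleteSpace V]
    (R : FellRep FD V) : Prop :=
  closure ((Submodule.span ℂ {ξ : V | ∃ d ∈ FD.fiber (1 : G), ∃ η : V, ξ = R.T d η} :
      Submodule ℂ V) : Set V) = Set.univ

section Aux

open scoped InnerProductSpace

/-- The unit fiber as a non-unital star subalgebra. -/
def FellBundle.unitFiber (FA : FellBundle G A) : NonUnitalStarSubalgebra ℂ A where
  carrier := FA.fiber 1
  add_mem' := fun ha hb => (FA.fiber 1).add_mem ha hb
  zero_mem' := (FA.fiber 1).zero_mem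
  mul_mem' := fun ha hb => by simpa using FA.mul_mem ha hb
  smul_mem' := fun c _ ha => (FA.fiber 1).smul_mem c ha
  star_mem' := fun ha => by simpa using FA.star_mem ha

theorem FellBundle.isClosed_unitFiber (FA : FellBundle G A) :
    IsClosed (FA.unitFiber : Set A) := FA.isClosed_fiber 1

theorem FellBundle.mem_unitFiber (FA : FellBundle G A) {a : A} :
    a ∈ FA.unitFiber ↔ a ∈ FA.fiber 1 := Iff.rfl

/-- Square root trick in a non-unital C*-algebra. -/
theorem exists_root_aux {A : Type*} [NonUnitalCStarAlgebra A] (a : A) (ha : IsSelfAdjoint a)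
    (m : ℝ) (hm : 0 ≤ m) (ham : ‖a‖ ≤ m ^ 2) :
    ∃ r : A, IsSelfAdjoint r ∧ ((2 * m : ℝ) : ℂ) • r - r * r = a := by
  let f : ℝ → ℝ := fun x => m - √(m ^ 2 - x)
  have hf : Continuous f := by fun_prop
  have hf0 : f 0 = 0 := by simp [f, Real.sqrt_sq hm]
  refine ⟨cfcₙ f a, cfcₙ_predicate f a, ?_⟩
  have h1 : cfcₙ (fun x => (2 * m) * f x - f x * f x) a = a := by
    conv_rhs => rw [← cfcₙ_id ℝ a ha]
    apply cfcₙ_congr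
    intro x hx
    have h2 := NonUnitalIsometricContinuousFunctionalCalculus.norm_quasispectrum_le a hx ha
    have h3 : x ≤ m ^ 2 := (le_abs_self x).trans (h2.trans ham)
    have h4 := Real.mul_self_sqrt (sub_nonneg.2 h3)
    simp only [f, id]
    linear_combination -h4
  rw [cfcₙ_sub (fun x => (2 * m) * f x) (fun x => f x * f x) a (by fun_prop) (by simp [hf0])
    (by fun_prop) (by simp [hf0]), cfcₙ_mul f f a (by fun_prop) hf0 (by fun_prop) hf0,
    cfcₙ_const_mul (2 * m) f a (by fun_prop) hf0] at h1
  conv_rhs => rw [← h1]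
  rw [Complex.coe_smul]

theorem FellBundle.exists_root (FA : FellBundle G A) {c : A} {s : G} (hc : c ∈ FA.fiber s) :
    ∃ r ∈ FA.fiber 1, star r = r ∧ ((2 * ‖c‖ : ℝ) : ℂ) • r - r * r = star c * c := by
  haveI := FA.isClosed_unitFiber
  have hm : star c * c ∈ FA.unitFiber := by
    rw [FA.mem_unitFiber]; simpa using FA.mul_mem (FA.star_mem hc) hc
  obtain ⟨r, hr, h⟩ := exists_root_aux (⟨star c * c, hm⟩ : FA.unitFiber)
    (by
      rw [isSelfAdjoint_iff]; ext; simp) ‖c‖ (norm_nonneg c)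
    (by
      change ‖star c * c‖ ≤ _
      rw [CStarRing.norm_star_mul_self, sq])
  exact ⟨r, r.2, congrArg Subtype.val hr, congrArg Subtype.val h⟩

variable {D : Type*} [NonUnitalCStarAlgebra D]
    {FC : FellBundle G A} {FD : FellBundle G D}
    {V : Type*} [NormedAddCommGroup V] [InnerProductSpace ℂ V] [CompleteSpace V]

theorem FellRep.norm_le (R : FellRep FD V) {d : D} (hd : d ∈ FD.fiber 1) : ‖R.T d‖ ≤ ‖d‖ := by
  haveI := FD.isClosed_unitFiber
  let φ : FD.unitFiber →⋆ₙₐ[ℂ] (V →L[ℂ] V) :=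
    { toFun := fun d => R.T d
      map_smul' := fun c x => R.smul_rep c x.2
      map_zero' := by simpa using R.smul_rep 0 (FD.fiber 1).zero_mem
      map_add' := fun x y => R.add_rep x.2 y.2
      map_mul' := fun x y => R.mul_rep x.2 y.2
      map_star' := fun x => R.star_rep x.2 }
  exact NonUnitalStarAlgHom.norm_apply_le φ ⟨d, hd⟩

theorem FellRep.inner_act (R : FellRep FD V) (E : AdjAction FC FD) {s t u : G} {c : A} {d d' : D}
    (hc : c ∈ FC.fiber s) (hd : d ∈ FD.fiber t) (hd' : d' ∈ FD.fiber u) (ξ η : V) :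
    ⟪R.T (E.act c d) ξ, R.T d' η⟫_ℂ = ⟪R.T d ξ, R.T (E.act (star c) d') η⟫_ℂ := by
  have h1 := E.act_mem hc hd
  rw [← ContinuousLinearMap.adjoint_inner_right, ← R.star_rep h1,
    ← ContinuousLinearMap.adjoint_inner_right, ← R.star_rep hd,
    ← ContinuousLinearMap.comp_apply, ← ContinuousLinearMap.comp_apply,
    ← R.mul_rep (FD.star_mem h1) hd',
    ← R.mul_rep (FD.star_mem hd) (E.act_mem (FC.star_mem hc) hd'), E.adjoint hc hd hd']

theorem FellRep.inner_act_act (R : FellRep FD V) (E : AdjAction FC FD) {s s' t u : G} {c c' : A}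
    {d d' : D} (hc : c ∈ FC.fiber s) (hc' : c' ∈ FC.fiber s')
    (hd : d ∈ FD.fiber t) (hd' : d' ∈ FD.fiber u) (ξ η : V) :
    ⟪R.T (E.act c d) ξ, R.T (E.act c' d') η⟫_ℂ =
      ⟪R.T d ξ, R.T (E.act (star c * c') d') η⟫_ℂ := by
  rw [R.inner_act E hc hd (E.act_mem hc' hd'), E.assoc (FC.star_mem hc) hc' hd']

/-- Formal sums. -/
noncomputable def sumMap (FD : FellBundle G D) (f : D → (V →L[ℂ] V)) :
    (FD.fiber 1 →₀ V) →ₗ[ℂ] V :=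
  Finsupp.lsum ℂ (fun d => (f (d : D)).toLinearMap)

@[simp] theorem sumMap_single (f : D → (V →L[ℂ] V)) (d : FD.fiber 1) (ξ : V) :
    sumMap FD f (Finsupp.single d ξ) = f d ξ := by
  simp [sumMap]

theorem sumMap_inner (f g f' g' : D → (V →L[ℂ] V))
    (h : ∀ d ∈ FD.fiber 1, ∀ d' ∈ FD.fiber 1, ∀ ξ η : V,
      ⟪f d ξ, g d' η⟫_ℂ = ⟪f' d ξ, g' d' η⟫_ℂ) (x y : FD.fiber 1 →₀ V) :
    ⟪sumMap FD f x, sumMap FD g y⟫_ℂ = ⟪sumMap FD f' x, sumMap FD g' y⟫_ℂ := by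
  induction x using Finsupp.induction_linear with
  | zero => simp
  | add x x' hx hx' => simp only [map_add, inner_add_left, hx, hx']
  | single d ξ =>
    induction y using Finsupp.induction_linear with
    | zero => simp
    | add x x' hx hx' => simp only [map_add, inner_add_right, hx, hx']
    | single d' η => simpa using h d d.2 d' d'.2 ξ η

theorem sumMap_act_lin (R : FellRep FD V) (E : AdjAction FC FD) {s : G} {c c' : A}
    (hc : c ∈ FC.fiber s) (hc' : c' ∈ FC.fiber s) (z : ℂ) (x : FD.fiber 1 →₀ V) :
    sumMap FD (fun d => R.T (E.act (z • c + c') d)) x =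
      z • sumMap FD (fun d => R.T (E.act c d)) x + sumMap FD (fun d => R.T (E.act c' d)) x := by
  induction x using Finsupp.induction_linear with
  | zero => simp
  | add x x' hx hx' => simp only [map_add, hx, hx', smul_add]; abel
  | single d ξ =>
    have h1 := E.act_mem hc d.2
    have h2 := E.act_mem hc' d.2
    simp only [sumMap_single]
    rw [E.add_act ((FC.fiber s).smul_mem z hc) hc' d.2, E.smul_act z hc d.2,
      R.add_rep ((FD.fiber _).smul_mem z h1) h2, R.smul_rep z h1]
    simp

theorem sumMap_bound (R : FellRep FD V) (E : AdjAction FC FD) {s : G} {c : A}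
    (hc : c ∈ FC.fiber s) (x : FD.fiber 1 →₀ V) :
    ‖sumMap FD (fun d => R.T (E.act c d)) x‖ ≤ ‖c‖ * ‖sumMap FD R.T x‖ := by
  obtain ⟨r, hr, hrs, hra⟩ := FC.exists_root hc
  have hrr : r * r ∈ FC.fiber 1 := by simpa using FC.mul_mem hr hr
  set P := sumMap FD R.T x with hP
  set Q := sumMap FD (fun d => R.T (E.act c d)) x with hQ
  set Qr := sumMap FD (fun d => R.T (E.act r d)) x with hQr
  set Qrr := sumMap FD (fun d => R.T (E.act (r * r) d)) x with hQrr
  set Qa := sumMap FD (fun d => R.T (E.act (star c * c) d)) x with hQa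
  have e1 : ⟪Q, Q⟫_ℂ = ⟪P, Qa⟫_ℂ :=
    sumMap_inner _ _ _ _ (fun d hd d' hd' ξ η => R.inner_act_act E hc hc hd hd' ξ η) x x
  have e2 : ⟪Qr, Qr⟫_ℂ = ⟪P, Qrr⟫_ℂ :=
    sumMap_inner _ _ _ _ (fun d hd d' hd' ξ η => by
      rw [R.inner_act_act E hr hr hd hd' ξ η, hrs]) x x
  have e3 : ⟪Qr, P⟫_ℂ = ⟪P, Qr⟫_ℂ :=
    sumMap_inner _ _ _ _ (fun d hd d' hd' ξ η => by
      rw [R.inner_act E hr hd hd' ξ η, hrs]) x x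
  have e4 : Qa = ((2 * ‖c‖ : ℝ) : ℂ) • Qr - Qrr := by
    have h1 := sumMap_act_lin R E hrr ((FC.fiber 1).smul_mem ((2 * ‖c‖ : ℝ) : ℂ) hr) (-1) x
    have h2 := sumMap_act_lin R E hr (FC.fiber 1).zero_mem ((2 * ‖c‖ : ℝ) : ℂ) x
    have h3 := sumMap_act_lin R E (FC.fiber 1).zero_mem (FC.fiber 1).zero_mem (1 : ℂ) x
    simp only [smul_zero, add_zero, one_smul] at h2 h3
    have h4 : sumMap FD (fun d => R.T (E.act 0 d)) x = 0 := by simpa using h3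
    rw [h4, add_zero] at h2
    rw [h2] at h1
    have h5 : (-1 : ℂ) • (r * r) + ((2 * ‖c‖ : ℝ) : ℂ) • r = star c * c := by
      rw [← hra, neg_one_smul]; abel
    rw [h5] at h1
    rw [hQa, h1, neg_one_smul]; abel
  have key : ⟪(‖c‖ : ℂ) • P - Qr, (‖c‖ : ℂ) • P - Qr⟫_ℂ =
      (‖c‖ : ℂ) ^ 2 * ⟪P, P⟫_ℂ - ⟪Q, Q⟫_ℂ := by
    rw [e1, e4]
    simp only [inner_sub_left, inner_sub_right, inner_smul_left, inner_smul_right, e2, e3,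
      Complex.conj_ofReal]
    push_cast
    ring
  simp only [inner_self_eq_norm_sq_to_K] at key
  have key2 : ‖(‖c‖ : ℂ) • P - Qr‖ ^ 2 = ‖c‖ ^ 2 * ‖P‖ ^ 2 - ‖Q‖ ^ 2 := by
    apply Complex.ofReal_injective
    push_cast
    exact key
  apply le_of_sq_le_sq _ (by positivity)
  nlinarith [sq_nonneg ‖(‖c‖ : ℂ) • P - Qr‖]

theorem FellRep.denseRange (R : FellRep FD V) (hR : R.Nondeg) :
    DenseRange (sumMap FD R.T) := by
  unfold FellRep.Nondeg at hR
  rw [← dense_iff_closure_eq] at hR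
  refine hR.mono ?_
  have : Submodule.span ℂ {ξ : V | ∃ d ∈ FD.fiber (1 : G), ∃ η : V, ξ = R.T d η} ≤
      LinearMap.range (sumMap FD R.T) := by
    rw [Submodule.span_le]
    rintro _ ⟨d, hd, η, rfl⟩
    exact ⟨Finsupp.single ⟨d, hd⟩ η, by simp⟩
  intro v hv
  exact this hv

theorem FellRep.ext_dense (R : FellRep FD V) (hR : R.Nondeg) {L M : V →L[ℂ] V}
    (h : ∀ d ∈ FD.fiber 1, ∀ ξ, L (R.T d ξ) = M (R.T d ξ)) : L = M := by
  have hd : Dense ((Submodule.span ℂ {ξ : V | ∃ d ∈ FD.fiber (1 : G), ∃ η : V, ξ = R.T d η} :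
      Submodule ℂ V) : Set V) := dense_iff_closure_eq.2 hR
  refine ContinuousLinearMap.ext_on hd ?_
  rintro _ ⟨d, hd, η, rfl⟩
  exact h d hd η

theorem FellRep.ext_inner (R : FellRep FD V) (hR : R.Nondeg) {v w : V}
    (h : ∀ d ∈ FD.fiber 1, ∀ ξ, ⟪v, R.T d ξ⟫_ℂ = ⟪w, R.T d ξ⟫_ℂ) : v = w := by
  have hd : Dense ((Submodule.span ℂ {ξ : V | ∃ d ∈ FD.fiber (1 : G), ∃ η : V, ξ = R.T d η} :
      Submodule ℂ V) : Set V) := dense_iff_closure_eq.2 hR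
  have : innerSL ℂ v = innerSL ℂ w := by
    refine ContinuousLinearMap.ext_on hd ?_
    rintro _ ⟨d, hd, η, rfl⟩
    exact h d hd η
  exact ext_inner_right ℂ (fun u => by simpa using congrArg (fun L => L u) this)

/-- The operator extending `T_d ξ ↦ T_{c·d} ξ`. -/
noncomputable def hatOp (R : FellRep FD V) (E : AdjAction FC FD) (c : A) : V →L[ℂ] V :=
  (sumMap FD (fun d => R.T (E.act c d))).extendOfNorm (sumMap FD R.T)

theorem hatOp_apply (R : FellRep FD V) (hR : R.Nondeg) (E : AdjAction FC FD) {s : G} {c : A}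
    (hc : c ∈ FC.fiber s) {d : D} (hd : d ∈ FD.fiber 1) (ξ : V) :
    hatOp R E c (R.T d ξ) = R.T (E.act c d) ξ := by
  have := LinearMap.extendOfNorm_eq (R.denseRange hR) ⟨‖c‖, sumMap_bound R E hc⟩
    (Finsupp.single ⟨d, hd⟩ ξ)
  simpa [hatOp] using this

theorem hatOp_star (R : FellRep FD V) (hR : R.Nondeg) (E : AdjAction FC FD) {s : G} {c : A}
    (hc : c ∈ FC.fiber s) : hatOp R E (star c) = ContinuousLinearMap.adjoint (hatOp R E c) := by
  apply R.ext_dense hR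
  intro d hd ξ
  apply R.ext_inner hR
  intro d' hd' η
  rw [ContinuousLinearMap.adjoint_inner_left, hatOp_apply R hR E hc hd',
    hatOp_apply R hR E (FC.star_mem hc) hd, R.inner_act E (FC.star_mem hc) hd hd', star_star]

theorem hatOp_apply' (R : FellRep FD V) (hR : R.Nondeg) (E : AdjAction FC FD) {s t : G} {c : A}
    (hc : c ∈ FC.fiber s) {d : D} (hd : d ∈ FD.fiber t) (ξ : V) :
    hatOp R E c (R.T d ξ) = R.T (E.act c d) ξ := by
  apply R.ext_inner hR
  intro d' hd' η
  rw [R.inner_act E hc hd hd', ← hatOp_apply R hR E (FC.star_mem hc) hd', hatOp_star R hR E hc,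
    ContinuousLinearMap.adjoint_inner_right]

/-- The extended representation. -/
noncomputable def hatRep (R : FellRep FD V) (hR : R.Nondeg) (E : AdjAction FC FD) :
    FellRep FC V where
  T := hatOp R E
  add_rep := by
    intro t c c' hc hc'
    apply R.ext_dense hR
    intro d hd ξ
    rw [ContinuousLinearMap.add_apply, hatOp_apply R hR E hc hd, hatOp_apply R hR E hc' hd,
      hatOp_apply R hR E ((FC.fiber t).add_mem hc hc') hd, E.add_act hc hc' hd,
      R.add_rep (E.act_mem hc hd) (E.act_mem hc' hd), ContinuousLinearMap.add_apply]
  smul_rep := by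
    intro t z c hc
    apply R.ext_dense hR
    intro d hd ξ
    rw [ContinuousLinearMap.smul_apply, hatOp_apply R hR E hc hd,
      hatOp_apply R hR E ((FC.fiber t).smul_mem z hc) hd, E.smul_act z hc hd,
      R.smul_rep z (E.act_mem hc hd), ContinuousLinearMap.smul_apply]
  mul_rep := by
    intro s t c c' hc hc'
    apply R.ext_dense hR
    intro d hd ξ
    rw [ContinuousLinearMap.comp_apply, hatOp_apply R hR E hc' hd,
      hatOp_apply' R hR E hc (E.act_mem hc' hd), hatOp_apply R hR E (FC.mul_mem hc hc') hd,
      E.assoc hc hc' hd]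
  star_rep := fun hc => hatOp_star R hR E hc

theorem hatRep_nondeg (R : FellRep FD V) (hR : R.Nondeg) (E : AdjAction FC FD) (hE : E.Nondeg) :
    (hatRep R hR E).Nondeg := by
  let W : Submodule ℂ V := (Submodule.span ℂ
    {ξ : V | ∃ c ∈ FC.fiber (1 : G), ∃ η : V, ξ = (hatRep R hR E).T c η}).topologicalClosure
  have hWc : IsClosed (W : Set V) := Submodule.isClosed_topologicalClosure _
  have hdense : Dense ((Submodule.span ℂ {ξ : V | ∃ d ∈ FD.fiber (1 : G), ∃ η : V, ξ = R.T d η} :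
      Submodule ℂ V) : Set V) := dense_iff_closure_eq.2 hR
  -- the span of the elements `(a a') · b` is mapped into `W`
  have h1 : ∀ x ∈ Submodule.span ℂ {x : D | ∃ a ∈ FC.fiber (1 : G), ∃ a' ∈ FC.fiber (1 : G)⁻¹,
      ∃ b ∈ FD.fiber (1 : G), x = E.act (a * a') b}, x ∈ FD.fiber 1 ∧ ∀ ξ, R.T x ξ ∈ W := by
    intro x hx
    induction hx using Submodule.span_induction with
    | mem x hx =>
      obtain ⟨a, ha, a', ha', b, hb, rfl⟩ := hx
      have haa : a * a' ∈ FC.fiber 1 := by simpa using FC.mul_mem ha ha'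
      refine ⟨by simpa using E.act_mem haa hb, fun ξ => ?_⟩
      apply Submodule.le_topologicalClosure
      apply Submodule.subset_span
      exact ⟨a * a', haa, R.T b ξ, (hatOp_apply R hR E haa hb ξ).symm⟩
    | zero =>
      refine ⟨(FD.fiber 1).zero_mem, fun ξ => ?_⟩
      have : R.T 0 = 0 := by simpa using R.smul_rep 0 (FD.fiber 1).zero_mem
      simp [this]
    | add x y _ _ hx hy =>
      refine ⟨(FD.fiber 1).add_mem hx.1 hy.1, fun ξ => ?_⟩
      rw [R.add_rep hx.1 hy.1]
      exact W.add_mem (hx.2 ξ) (hy.2 ξ)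
    | smul z x _ hx =>
      refine ⟨(FD.fiber 1).smul_mem z hx.1, fun ξ => ?_⟩
      rw [R.smul_rep z hx.1]
      exact W.smul_mem z (hx.2 ξ)
  have h2 : ∀ d ∈ FD.fiber 1, ∀ d' ∈ FD.fiber 1, ∀ ξ, R.T (d * d') ξ ∈ W := by
    intro d hd d' hd' ξ
    have hdd : d * d' ∈ FD.fiber 1 := by simpa using FD.mul_mem hd hd'
    have hmem : d * d' ∈ cspan {x : D | ∃ b ∈ FD.fiber (1 : G), ∃ b' ∈ FD.fiber (1 : G)⁻¹,
        x = b * b'} :=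
      subset_closure (Submodule.subset_span ⟨d, hd, d', by simpa using hd', rfl⟩)
    rw [← hE 1] at hmem
    unfold cspan at hmem
    change _ ∈ (W : Set V)
    rw [← hWc.closure_eq]
    rw [Metric.mem_closure_iff] at hmem ⊢
    intro ε hε
    obtain ⟨x, hx, hxd⟩ := hmem (ε / (‖ξ‖ + 1)) (by positivity)
    obtain ⟨hx1, hxW⟩ := h1 x hx
    refine ⟨R.T x ξ, hxW ξ, ?_⟩
    have hsub : R.T (d * d') ξ - R.T x ξ = R.T (d * d' - x) ξ := by
      have e := R.add_rep ((FD.fiber 1).sub_mem hdd hx1) hx1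
      rw [sub_add_cancel] at e
      rw [e]; simp
    rw [dist_eq_norm, hsub]
    rw [dist_eq_norm] at hxd
    calc ‖R.T (d * d' - x) ξ‖ ≤ ‖d * d' - x‖ * ‖ξ‖ :=
          ((R.T _).le_opNorm ξ).trans (mul_le_mul_of_nonneg_right
            (R.norm_le ((FD.fiber 1).sub_mem hdd hx1)) (norm_nonneg _))
      _ ≤ ‖d * d' - x‖ * (‖ξ‖ + 1) := by gcongr; linarith
      _ < ε := (lt_div_iff₀ (by positivity)).1 hxd
  have h3 : ∀ d ∈ FD.fiber 1, ∀ ξ, R.T d ξ ∈ W := by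
    intro d hd ξ
    have hcl : IsClosed {ξ : V | R.T d ξ ∈ W} := hWc.preimage (R.T d).continuous
    have hsub : ((Submodule.span ℂ {ξ : V | ∃ d ∈ FD.fiber (1 : G), ∃ η : V, ξ = R.T d η} :
      Submodule ℂ V) : Set V) ⊆ {ξ : V | R.T d ξ ∈ W} := by
      change _ ≤ W.comap (R.T d).toLinearMap
      rw [Submodule.span_le]
      rintro _ ⟨d', hd', η, rfl⟩
      have := h2 d hd d' hd' η
      rw [R.mul_rep hd hd'] at this
      exact this
    exact hcl.closure_subset_iff.2 hsub (hdense ξ)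
  have h4 : Submodule.span ℂ {ξ : V | ∃ d ∈ FD.fiber (1 : G), ∃ η : V, ξ = R.T d η} ≤ W := by
    rw [Submodule.span_le]
    rintro _ ⟨d, hd, η, rfl⟩
    exact h3 d hd η
  unfold FellRep.Nondeg
  rw [Set.eq_univ_iff_forall]
  intro v
  exact hWc.closure_subset_iff.2 h4 (hdense v)

end Aux

/-- Given a non-degenerate *-representation `T` of a Fell bundle `𝒟` on a
Hilbert space `V` and a non-degenerate action by adjointable maps of a Fell
bundle `𝒞` on `𝒟`, there is a unique *-representation `T̂` of `𝒞` on `V` with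
`T̂_c T_d ξ = T_{c·d} ξ` for all bundle elements `c, d` and `ξ ∈ V`; moreover
`T̂` is non-degenerate. -/
theorem exists_unique_extension_rep {D : Type*} [NonUnitalCStarAlgebra D]
    {FC : FellBundle G A} {FD : FellBundle G D}
    {V : Type*} [NormedAddCommGroup V] [InnerProductSpace ℂ V] [CompleteSpace V]
    (R : FellRep FD V) (hR : R.Nondeg)
    (E : AdjAction FC FD) (hE : E.Nondeg) :
    ∃ S : FellRep FC V,
      (∀ (s t : G) (c : A) (d : D) (ξ : V), c ∈ FC.fiber s → d ∈ FD.fiber t →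
        S.T c (R.T d ξ) = R.T (E.act c d) ξ) ∧
      S.Nondeg ∧
      (∀ S' : FellRep FC V,
        (∀ (s t : G) (c : A) (d : D) (ξ : V), c ∈ FC.fiber s → d ∈ FD.fiber t →
          S'.T c (R.T d ξ) = R.T (E.act c d) ξ) →
        ∀ (t : G) (c : A), c ∈ FC.fiber t → S'.T c = S.T c) := by
  refine ⟨hatRep R hR E, fun s t c d ξ hc hd => hatOp_apply' R hR E hc hd ξ,
    hatRep_nondeg R hR E hE, fun S' hS' t c hc => ?_⟩
  apply R.ext_dense hR
  intro d hd ξ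
  rw [hS' t 1 c d ξ hc hd]
  exact (hatOp_apply R hR E hc hd ξ).symm
end
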